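/- arXiv:2511.17046 — 4 statements merged into one kernel-verified Lean document; each statement's English description precedes it below -/
import Mathlib

section
/- Let k ∈ ℕ and ξ ∈ ℝ. For n ∈ ℕ define r_n = ((log n + ((3k)/2 − 1)·log(log n) + ξ)/(π·n))^{1/3} and a_n(t) = (π/3)·(2·r_n³ + 3·r_n²·t − t³). Then the sequence n · ∫₀^{r_n/2} (n·a_n(t))^k · exp(−n·a_n(t)) / k! dt converges, as n → ∞, to e^{−2ξ/3} · π^{−1/3} · (2/3)^k / k!. -/
open Real Filter MeasureTheory

/-- The rescaled integrand `(2/3 + u/L - u³/(3L³))^k e^{-u + u³/(3L²)}` integrates over `[0, L/2]`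
to a quantity converging to `(2/3)^k ∫₀^∞ e^{-u} du = (2/3)^k`. -/
theorem tendsto_rescaled_integral (k : ℕ) :
    Tendsto (fun L : ℝ => ∫ u in (0 : ℝ)..(L / 2),
      (2 / 3 + u / L - u ^ 3 / (3 * L ^ 3)) ^ k * Real.exp (-u + u ^ 3 / (3 * L ^ 2)))
      atTop (nhds ((2 / 3) ^ k)) := by
  have hint : ∫ u in Set.Ioi (0 : ℝ), (2 / 3 : ℝ) ^ k * Real.exp (-u) = (2 / 3) ^ k := by
    rw [integral_const_mul, integral_exp_neg_Ioi_zero, mul_one]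
  rw [← hint]
  have hlim : Tendsto (fun L : ℝ => ∫ u in Set.Ioi (0 : ℝ), (Set.Ioc 0 (L / 2)).indicator
      (fun u => (2 / 3 + u / L - u ^ 3 / (3 * L ^ 3)) ^ k * Real.exp (-u + u ^ 3 / (3 * L ^ 2))) u)
      atTop (nhds (∫ u in Set.Ioi (0 : ℝ), (2 / 3 : ℝ) ^ k * Real.exp (-u))) := by
    refine tendsto_integral_filter_of_dominated_convergence
      (fun u => (7 / 6 : ℝ) ^ k * Real.exp (-(11 / 12) * u)) ?_ ?_ ?_ ?_
    · refine Eventually.of_forall fun L => ?_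
      exact ((by fun_prop : Measurable _).indicator measurableSet_Ioc).aestronglyMeasurable
    · filter_upwards [eventually_gt_atTop 0] with L hL
      refine Eventually.of_forall fun u => ?_
      by_cases hu : u ∈ Set.Ioc 0 (L / 2)
      · rw [Set.indicator_of_mem hu]
        obtain ⟨hu0, huL⟩ := hu
        have hv0 : 0 < u / L := by positivity
        have hv : u / L ≤ 1 / 2 := by rw [div_le_iff₀ hL]; linarith
        have hcube : u ^ 3 / (3 * L ^ 3) = (u / L) ^ 3 / 3 := by field_simp
        have hsq : u ^ 3 / (3 * L ^ 2) = u * (u / L) ^ 2 / 3 := by field_simp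
        have hv2 : (u / L) ^ 2 ≤ 1 / 4 := by nlinarith
        have hv3 : (u / L) ^ 3 ≤ u / L := by nlinarith
        have hpos : 0 < (u / L) ^ 3 := by positivity
        rw [hcube, hsq, norm_mul, norm_pow, Real.norm_eq_abs, Real.norm_eq_abs, Real.abs_exp,
          abs_of_nonneg (by linarith)]
        gcongr
        · linarith
        · linarith
        · nlinarith
      · rw [Set.indicator_of_notMem hu, norm_zero]
        positivity
    · exact (integrableOn_exp_mul_Ioi (by norm_num) 0).const_mul _
    · refine (ae_restrict_iff' measurableSet_Ioi).2 (Eventually.of_forall fun u hu => ?_)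
      have hlin : Tendsto (fun L : ℝ => u / L) atTop (nhds 0) :=
        tendsto_const_nhds.div_atTop tendsto_id
      have hcube : Tendsto (fun L : ℝ => u ^ 3 / (3 * L ^ 3)) atTop (nhds 0) :=
        tendsto_const_nhds.div_atTop
          ((tendsto_pow_atTop (by norm_num)).const_mul_atTop (by norm_num))
      have hsq : Tendsto (fun L : ℝ => u ^ 3 / (3 * L ^ 2)) atTop (nhds 0) :=
        tendsto_const_nhds.div_atTop
          ((tendsto_pow_atTop (by norm_num)).const_mul_atTop (by norm_num))
      have hprod := (((hlin.const_add (2 / 3)).sub hcube).pow k).mul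
        ((Real.continuous_exp.tendsto _).comp (hsq.const_add (-u)))
      rw [add_zero, sub_zero, add_zero] at hprod
      refine hprod.congr' ?_
      filter_upwards [eventually_ge_atTop (2 * u)] with L hL
      rw [Set.indicator_of_mem (show u ∈ Set.Ioc 0 (L / 2) from ⟨hu, by linarith⟩)]
      rfl
  refine hlim.congr' ?_
  filter_upwards [eventually_ge_atTop 0] with L hL
  rw [intervalIntegral.integral_of_le (by linarith), setIntegral_indicator measurableSet_Ioc,
    Set.inter_eq_right.2 Set.Ioc_subset_Ioi_self]

/-- The substitution `t = (ρ / L) u`, where `L = π m ρ³`. -/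
theorem boundary_layer_integral_eq_rescaled (k : ℕ) {m ρ L : ℝ} (hL : 0 < L)
    (hρ : m * (π * ρ ^ 3) = L) :
    ∫ t in (0 : ℝ)..(ρ / 2),
        (m * (π / 3 * (2 * ρ ^ 3 + 3 * ρ ^ 2 * t - t ^ 3))) ^ k *
          Real.exp (-(m * (π / 3 * (2 * ρ ^ 3 + 3 * ρ ^ 2 * t - t ^ 3)))) / (Nat.factorial k) =
      ρ / L * (L ^ k * Real.exp (-(2 / 3 * L))) / (Nat.factorial k) *
        ∫ u in (0 : ℝ)..(L / 2),
          (2 / 3 + u / L - u ^ 3 / (3 * L ^ 3)) ^ k * Real.exp (-u + u ^ 3 / (3 * L ^ 2)) := by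
  have hsub := intervalIntegral.smul_integral_comp_mul_left (a := 0) (b := L / 2)
    (fun t => (m * (π / 3 * (2 * ρ ^ 3 + 3 * ρ ^ 2 * t - t ^ 3))) ^ k *
      Real.exp (-(m * (π / 3 * (2 * ρ ^ 3 + 3 * ρ ^ 2 * t - t ^ 3)))) / (Nat.factorial k)) (ρ / L)
  rw [mul_zero, show ρ / L * (L / 2) = ρ / 2 by field_simp] at hsub
  rw [← hsub, smul_eq_mul, ← intervalIntegral.integral_const_mul,
    ← intervalIntegral.integral_const_mul]
  refine intervalIntegral.integral_congr fun u _ => ?_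
  have harea : m * (π / 3 * (2 * ρ ^ 3 + 3 * ρ ^ 2 * (ρ / L * u) - (ρ / L * u) ^ 3)) =
      L * (2 / 3 + u / L - u ^ 3 / (3 * L ^ 3)) := by
    calc _ = m * (π * ρ ^ 3) * (2 / 3 + u / L - u ^ 3 / (3 * L ^ 3)) := by field_simp
      _ = _ := by rw [hρ]
  have hexp : -(L * (2 / 3 + u / L - u ^ 3 / (3 * L ^ 3))) =
      -(2 / 3 * L) + (-u + u ^ 3 / (3 * L ^ 2)) := by field_simp; ring
  rw [harea, hexp, Real.exp_add, mul_pow]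
  ring

/-- The prefactor produced by the rescaling, in closed form. -/
theorem rescaling_prefactor_eq (k : ℕ) {m L ξ : ℝ} (hm : 0 < m) (hlog : 0 < Real.log m)
    (hL : 0 < L)
    (hLm : L = Real.log m + (3 * (k : ℝ) / 2 - 1) * Real.log (Real.log m) + ξ) :
    m * ((L / (π * m)) ^ ((1 : ℝ) / 3) / L * (L ^ k * Real.exp (-(2 / 3 * L)))) =
      Real.exp (-(2 * ξ / 3)) * π ^ (-(1 : ℝ) / 3) * (L / Real.log m) ^ ((k : ℝ) - 2 / 3) := by
  have hπ := Real.pi_pos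
  apply Real.log_injOn_pos (Set.mem_Ioi.2 (by positivity)) (Set.mem_Ioi.2 (by positivity))
  rw [Real.log_mul (by positivity) (by positivity), Real.log_mul (by positivity) (by positivity),
    Real.log_div (by positivity) (by positivity), Real.log_rpow (by positivity),
    Real.log_div (by positivity) (by positivity), Real.log_mul (by positivity) (by positivity),
    Real.log_mul (by positivity) (by positivity), Real.log_pow, Real.log_exp,
    Real.log_mul (by positivity) (by positivity), Real.log_mul (by positivity) (by positivity),
    Real.log_exp, Real.log_rpow (by positivity), Real.log_rpow (by positivity),
    Real.log_div (by positivity) (by positivity)]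
  linear_combination (-(2 : ℝ) / 3) * hLm

/-- With `r_n = ((log n + ((3k)/2 − 1)·log(log n) + ξ)/(π·n))^{1/3}` and
`a_n(t) = (π/3)(2r_n³ + 3r_n²t − t³)`, the sequence
`n ∫₀^{r_n/2} (n a_n(t))^k e^{−n a_n(t)}/k! dt` converges to
`e^{−2ξ/3} π^{−1/3} (2/3)^k / k!`. -/
theorem tendsto_boundary_layer_integral (k : ℕ) (ξ : ℝ)
    (r : ℕ → ℝ)
    (hr : ∀ n : ℕ, r n =
      ((Real.log n + (3 * (k : ℝ) / 2 - 1) * Real.log (Real.log n) + ξ) / (π * n)) ^ ((1 : ℝ) / 3))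
    (a : ℕ → ℝ → ℝ)
    (ha : ∀ (n : ℕ) (t : ℝ), a n t = π / 3 * (2 * (r n) ^ 3 + 3 * (r n) ^ 2 * t - t ^ 3)) :
    Tendsto (fun n : ℕ =>
        (n : ℝ) * ∫ t in (0 : ℝ)..(r n / 2),
          ((n : ℝ) * a n t) ^ k * Real.exp (-((n : ℝ) * a n t)) / (Nat.factorial k))
      atTop
      (nhds (Real.exp (-(2 * ξ / 3)) * π ^ (-(1 : ℝ) / 3) * (2 / 3) ^ k / (Nat.factorial k))) := by
  set L : ℕ → ℝ := fun n =>
    Real.log n + (3 * (k : ℝ) / 2 - 1) * Real.log (Real.log n) + ξ with hLdef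
  have hlog : Tendsto (fun n : ℕ => Real.log n) atTop atTop :=
    Real.tendsto_log_atTop.comp tendsto_natCast_atTop_atTop
  have hratio : Tendsto (fun n : ℕ => L n / Real.log n) atTop (nhds 1) := by
    have hloglog : Tendsto (fun n : ℕ => Real.log (Real.log n) / Real.log n) atTop (nhds 0) :=
      Real.isLittleO_log_id_atTop.tendsto_div_nhds_zero.comp hlog
    have hconst : Tendsto (fun n : ℕ => ξ / Real.log n) atTop (nhds 0) :=
      tendsto_const_nhds.div_atTop hlog
    have hsum := ((hloglog.const_mul (3 * (k : ℝ) / 2 - 1)).const_add 1).add hconst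
    rw [mul_zero, add_zero, add_zero] at hsum
    refine hsum.congr' ?_
    filter_upwards [hlog.eventually_gt_atTop 0] with n hn
    simp only [hLdef]
    field_simp
  have hLtop : Tendsto L atTop atTop := by
    refine (hratio.pos_mul_atTop one_pos hlog).congr' ?_
    filter_upwards [hlog.eventually_gt_atTop 0] with n hn
    exact div_mul_cancel₀ _ hn.ne'
  have hpow : Tendsto (fun n : ℕ => (L n / Real.log n) ^ ((k : ℝ) - 2 / 3)) atTop (nhds 1) := by
    simpa using hratio.rpow_const (p := (k : ℝ) - 2 / 3) (Or.inl one_ne_zero)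
  have hmain := ((hpow.const_mul (Real.exp (-(2 * ξ / 3)) * π ^ (-(1 : ℝ) / 3))).mul
    ((tendsto_rescaled_integral k).comp hLtop)).div_const (Nat.factorial k : ℝ)
  rw [mul_one] at hmain
  refine hmain.congr' ?_
  filter_upwards [hlog.eventually_gt_atTop 0, hLtop.eventually_gt_atTop 0, eventually_gt_atTop 0]
    with n hn hLn hn0
  have hm : (0 : ℝ) < n := Nat.cast_pos.2 hn0
  have hrL : r n = (L n / (π * n)) ^ ((1 : ℝ) / 3) := hr n
  have hcube : (n : ℝ) * (π * r n ^ 3) = L n := by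
    have hπ := Real.pi_pos
    rw [hrL, ← Real.rpow_natCast, ← Real.rpow_mul (by positivity)]
    norm_num
    field_simp
  simp only [ha]
  rw [boundary_layer_integral_eq_rescaled k hLn hcube,
    ← rescaling_prefactor_eq k hm hn hLn rfl, ← hrL]
  simp only [Function.comp_apply]
  ring
end

section
/- Let k ∈ ℕ and ξ ∈ ℝ. For n ∈ ℕ define r_n = ((log n + ((3k)/2 − 1)·log(log n) + ξ)/(π·n))^{1/3} and s_n = n·π·r_n³. Then the sequence (1/(π·r_n²)) · exp(−(2/3)·s_n) · Σ_{i=0}^{k} ((2/3)·s_n)^i / i! converges, as n → ∞, to e^{−2ξ/3} · π^{−1/3} · (2/3)^k / k!. -/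
open Real Filter

lemma tendsto_sum_pow_div_pow_atTop (a : ℕ → ℝ) (k : ℕ) :
    Tendsto (fun x : ℝ => (∑ i ∈ Finset.range (k + 1), a i * x ^ i) / x ^ k) atTop
      (nhds (a k)) := by
  have h0 : Tendsto (fun x : ℝ => ∑ i ∈ Finset.range k, a i * (x ^ i / x ^ k)) atTop
      (nhds 0) := by
    have := tendsto_finsetSum (Finset.range k) (f := fun i (x : ℝ) => a i * (x ^ i / x ^ k))
      (x := atTop) (a := fun i => a i * 0) fun i hi =>
        (tendsto_pow_div_pow_atTop_zero (𝕜 := ℝ) (Finset.mem_range.mp hi)).const_mul (a i)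
    simpa using this
  have h1 := h0.add_const (a k)
  rw [zero_add] at h1
  refine h1.congr' ?_
  filter_upwards [eventually_gt_atTop 0] with x hx
  rw [Finset.sum_range_succ, add_div, Finset.sum_div]
  congr 1
  · exact Finset.sum_congr rfl fun i _ => (mul_div_assoc _ _ _).symm
  · field_simp

lemma tendsto_add_mul_log_add_div_self (c ξ : ℝ) :
    Tendsto (fun L : ℝ => (L + c * Real.log L + ξ) / L) atTop (nhds 1) := by
  have hlog : Tendsto (fun L : ℝ => Real.log L / L) atTop (nhds 0) :=
    Real.isLittleO_log_id_atTop.tendsto_div_nhds_zero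
  have hξ : Tendsto (fun L : ℝ => ξ / L) atTop (nhds 0) := tendsto_id.const_div_atTop ξ
  have h := ((hlog.const_mul c).const_add 1).add hξ
  simp only [mul_zero, add_zero] at h
  refine h.congr' ?_
  filter_upwards [eventually_gt_atTop 0] with L hL
  field_simp

lemma boundary_factor_eq (k ξ N x : ℝ) (hN : 0 < N) (hL : 0 < Real.log N) (hx : 0 < x)
    (hxdef : x = Real.log N + (3 * k / 2 - 1) * Real.log (Real.log N) + ξ) :
    1 / (π * ((x / (π * N)) ^ ((1 : ℝ) / 3)) ^ 2) * Real.exp (-(2 / 3) * x) =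
      Real.exp (-(2 * ξ / 3)) * π ^ (-(1 : ℝ) / 3) * (x / Real.log N) ^ (k - 2 / 3) / x ^ k := by
  have hπ := Real.pi_pos
  have hq : 0 < x / (π * N) := by positivity
  have hl : 0 < 1 / (π * ((x / (π * N)) ^ ((1 : ℝ) / 3)) ^ 2) * Real.exp (-(2 / 3) * x) := by
    positivity
  have hr : 0 < Real.exp (-(2 * ξ / 3)) * π ^ (-(1 : ℝ) / 3) *
      (x / Real.log N) ^ (k - 2 / 3) / x ^ k := by positivity
  refine Real.log_injOn_pos hl hr ?_
  rw [Real.log_mul (by positivity) (by positivity), one_div, Real.log_inv,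
    Real.log_mul (by positivity) (by positivity), Real.log_pow, Real.log_rpow hq,
    Real.log_div hx.ne' (by positivity), Real.log_mul hπ.ne' hN.ne', Real.log_exp,
    Real.log_div (by positivity) (by positivity), Real.log_mul (by positivity) (by positivity),
    Real.log_mul (by positivity) (by positivity), Real.log_exp, Real.log_rpow hπ,
    Real.log_rpow (by positivity), Real.log_rpow hx, Real.log_div hx.ne' hL.ne']
  push_cast
  linear_combination (-(2 : ℝ) / 3) * hxdef

/-- The boundary term at `t = 0` in the integration by parts:
`(1/(π r_n²))·e^{−(2/3)s_n}·Σ_{i=0}^{k} ((2/3)s_n)^i/i!` converges to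
`e^{−2ξ/3}·π^{−1/3}·(2/3)^k/k!`. -/
theorem tendsto_boundary_term_at_zero (k : ℕ) (ξ : ℝ)
    (r : ℕ → ℝ)
    (hr : ∀ n : ℕ, r n =
      ((Real.log n + (3 * (k : ℝ) / 2 - 1) * Real.log (Real.log n) + ξ) / (π * n)) ^ ((1 : ℝ) / 3))
    (s : ℕ → ℝ) (hs : ∀ n : ℕ, s n = (n : ℝ) * π * (r n) ^ 3) :
    Tendsto (fun n : ℕ =>
        (1 / (π * (r n) ^ 2)) * Real.exp (-(2 / 3) * s n) *
          ∑ i ∈ Finset.range (k + 1), ((2 / 3) * s n) ^ i / (Nat.factorial i))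
      atTop
      (nhds (Real.exp (-(2 * ξ / 3)) * π ^ (-(1 : ℝ) / 3) * (2 / 3) ^ k / (Nat.factorial k))) := by
  set x : ℕ → ℝ := fun n =>
    Real.log n + (3 * (k : ℝ) / 2 - 1) * Real.log (Real.log n) + ξ with hx
  have hL : Tendsto (fun n : ℕ => Real.log n) atTop atTop :=
    Real.tendsto_log_atTop.comp tendsto_natCast_atTop_atTop
  have hratio : Tendsto (fun n : ℕ => x n / Real.log n) atTop (nhds 1) :=
    (tendsto_add_mul_log_add_div_self (3 * (k : ℝ) / 2 - 1) ξ).comp hL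
  have hxtop : Tendsto x atTop atTop := by
    refine (hratio.pos_mul_atTop one_pos hL).congr' ?_
    filter_upwards [hL.eventually_gt_atTop 0] with n hn
    exact div_mul_cancel₀ _ hn.ne'
  have hpow : Tendsto (fun n : ℕ => (x n / Real.log n) ^ ((k : ℝ) - 2 / 3)) atTop (nhds 1) := by
    simpa using hratio.rpow_const (p := (k : ℝ) - 2 / 3) (Or.inl one_ne_zero)
  have hsum := (tendsto_sum_pow_div_pow_atTop
    (fun i => (2 / 3 : ℝ) ^ i / (Nat.factorial i)) k).comp hxtop
  have h := (hpow.const_mul (Real.exp (-(2 * ξ / 3)) * π ^ (-(1 : ℝ) / 3))).mul hsum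
  rw [mul_one, ← mul_div_assoc] at h
  refine h.congr' ?_
  filter_upwards [hL.eventually_gt_atTop 0, hxtop.eventually_gt_atTop 0,
    eventually_gt_atTop 0] with n hLn hxn hn
  have hN : (0 : ℝ) < n := Nat.cast_pos.mpr hn
  have hrn : r n = (x n / (π * n)) ^ ((1 : ℝ) / 3) := hr n
  have hsn : s n = x n := by
    rw [hs, hrn, ← Real.rpow_natCast, ← Real.rpow_mul (by positivity)]
    norm_num
    field_simp
  rw [hsn, hrn, boundary_factor_eq k ξ n (x n) hN hLn hxn rfl, Real.rpow_natCast]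
  simp only [Function.comp_apply, div_mul_eq_mul_div _ _ (_ ^ _), ← mul_pow]
  ring
end

section
/- Let k ∈ ℕ, ξ ∈ ℝ and C > 0. For n ∈ ℕ define r_n = ((log n + ((3k)/2 − 1)·log(log n) + ξ)/(π·n))^{1/3}. Suppose (a_n) and (b_n) are sequences of real numbers such that for all sufficiently large n one has (2/3)·π·r_n³ ≤ a_n ≤ b_n ≤ a_n + C·r_n⁴. Then the ratio ((n·b_n)^k · exp(−n·b_n)) / ((n·a_n)^k · exp(−n·a_n)) converges to 1 as n → ∞. -/
open Real Filter

/-- The threshold `log x + c log log x + ξ` is asymptotic to `log x`. -/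
lemma tendsto_log_add_loglog_div_log (c ξ : ℝ) :
    Tendsto (fun x : ℝ => (Real.log x + c * Real.log (Real.log x) + ξ) / Real.log x)
      atTop (nhds 1) := by
  have h₁ : Tendsto (fun x : ℝ => Real.log (Real.log x) / Real.log x) atTop (nhds 0) :=
    Real.isLittleO_log_id_atTop.tendsto_div_nhds_zero.comp Real.tendsto_log_atTop
  have h₂ : Tendsto (fun x : ℝ => ξ / Real.log x) atTop (nhds 0) :=
    Real.tendsto_log_atTop.const_div_atTop ξ
  have h := ((h₁.const_mul c).const_add 1).add h₂
  simp only [mul_zero, add_zero] at h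
  refine h.congr' ?_
  filter_upwards [eventually_gt_atTop 1] with x hx
  have := Real.log_pos hx
  field_simp

/-- Powers of the threshold `log x + c log log x + ξ` are negligible against `x`. -/
lemma tendsto_log_add_loglog_pow_div (c ξ : ℝ) (m : ℕ) :
    Tendsto (fun x : ℝ => (Real.log x + c * Real.log (Real.log x) + ξ) ^ m / x)
      atTop (nhds 0) := by
  have h₁ : Tendsto (fun x : ℝ => Real.log x ^ m / x) atTop (nhds 0) :=
    (isLittleO_pow_log_id_atTop (n := m)).tendsto_div_nhds_zero
  have h := ((tendsto_log_add_loglog_div_log c ξ).pow m).mul h₁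
  simp only [mul_zero] at h
  refine h.congr' ?_
  filter_upwards [eventually_gt_atTop 1] with x hx
  rw [← mul_div_assoc, ← mul_pow, div_mul_cancel₀ _ (Real.log_pos hx).ne']

/-- The threshold `log x + c log log x + ξ` is eventually positive. -/
lemma eventually_log_add_loglog_pos (c ξ : ℝ) :
    ∀ᶠ x : ℝ in atTop, 0 < Real.log x + c * Real.log (Real.log x) + ξ := by
  filter_upwards [(tendsto_log_add_loglog_div_log c ξ).eventually_const_lt zero_lt_one,
    eventually_gt_atTop 1] with x h hx
  exact (div_pos_iff_of_pos_right (Real.log_pos hx)).mp h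

/-- A sequence of eventually nonnegative reals whose cubes tend to zero tends to zero. -/
lemma tendsto_zero_of_cube {u : ℕ → ℝ} (h₀ : ∀ᶠ n in atTop, 0 ≤ u n)
    (h : Tendsto (fun n => u n ^ 3) atTop (nhds 0)) : Tendsto u atTop (nhds 0) := by
  have h' := h.rpow_const (p := (1 : ℝ) / 3) (Or.inr (by norm_num))
  rw [Real.zero_rpow (by norm_num)] at h'
  refine h'.congr' ?_
  filter_upwards [h₀] with n hn
  rw [← Real.rpow_natCast, ← Real.rpow_mul hn]
  norm_num

/-- If `(2/3)π r_n³ ≤ a_n ≤ b_n ≤ a_n + C r_n⁴` eventually, then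
`((n b_n)^k e^{−n b_n}) / ((n a_n)^k e^{−n a_n}) → 1`. -/
theorem tendsto_ratio_one (k : ℕ) (ξ : ℝ) (C : ℝ) (hC : 0 < C)
    (r : ℕ → ℝ)
    (hr : ∀ n : ℕ, r n =
      ((Real.log n + (3 * (k : ℝ) / 2 - 1) * Real.log (Real.log n) + ξ) / (π * n)) ^ ((1 : ℝ) / 3))
    (a b : ℕ → ℝ)
    (hab : ∀ᶠ n : ℕ in atTop,
      (2 / 3) * π * (r n) ^ 3 ≤ a n ∧ a n ≤ b n ∧ b n ≤ a n + C * (r n) ^ 4) :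
    Tendsto (fun n : ℕ =>
        (((n : ℝ) * b n) ^ k * Real.exp (-((n : ℝ) * b n))) /
          (((n : ℝ) * a n) ^ k * Real.exp (-((n : ℝ) * a n))))
      atTop (nhds 1) := by
  set c : ℝ := 3 * (k : ℝ) / 2 - 1 with hc
  have hpos : ∀ᶠ n : ℕ in atTop, 0 < (n : ℝ) ∧
      0 < Real.log n + c * Real.log (Real.log n) + ξ := by
    filter_upwards [eventually_gt_atTop 0,
      tendsto_natCast_atTop_atTop.eventually (eventually_log_add_loglog_pos c ξ)] with n h₁ h₂
    exact ⟨by exact_mod_cast h₁, h₂⟩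
  have hr_pos : ∀ᶠ n : ℕ in atTop, 0 < r n := by
    filter_upwards [hpos] with n ⟨hn, hL⟩
    rw [hr]
    positivity
  have hr_cube : ∀ᶠ n : ℕ in atTop,
      r n ^ 3 = (Real.log n + c * Real.log (Real.log n) + ξ) / (π * n) := by
    filter_upwards [hpos] with n ⟨hn, hL⟩
    rw [hr, ← Real.rpow_natCast, ← Real.rpow_mul (by positivity)]
    norm_num
  have hr_zero : Tendsto r atTop (nhds 0) := by
    refine tendsto_zero_of_cube (hr_pos.mono fun n h => h.le) ?_
    have h := ((tendsto_log_add_loglog_pow_div c ξ 1).comp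
      (tendsto_natCast_atTop_atTop (R := ℝ))).div_const π
    rw [zero_div] at h
    refine h.congr' ?_
    filter_upwards [hr_cube, hpos] with n h₁ ⟨hn, hL⟩
    rw [h₁]
    simp only [Function.comp_apply, pow_one]
    field_simp
  have hx_zero : Tendsto (fun n : ℕ => (n : ℝ) * r n ^ 4) atTop (nhds 0) := by
    refine tendsto_zero_of_cube (hr_pos.mono fun n h => by positivity) ?_
    have h := ((tendsto_log_add_loglog_pow_div c ξ 4).comp
      (tendsto_natCast_atTop_atTop (R := ℝ))).div_const (π ^ 4)
    rw [zero_div] at h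
    refine h.congr' ?_
    filter_upwards [hr_cube, hpos] with n h₁ ⟨hn, hL⟩
    have h₂ : ((n : ℝ) * r n ^ 4) ^ 3 = (n : ℝ) ^ 3 * (r n ^ 3) ^ 4 := by ring
    rw [h₂, h₁]
    simp only [Function.comp_apply]
    field_simp
  have ha_pos : ∀ᶠ n : ℕ in atTop, 0 < a n := by
    filter_upwards [hab, hr_pos] with n ⟨h₁, _, _⟩ h
    exact lt_of_lt_of_le (by positivity) h₁
  have hquot : Tendsto (fun n => b n / a n) atTop (nhds 1) := by
    have hup : Tendsto (fun n => 1 + C / ((2 / 3) * π) * r n) atTop (nhds 1) := by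
      simpa using (hr_zero.const_mul (C / ((2 / 3) * π))).const_add 1
    refine tendsto_of_tendsto_of_tendsto_of_le_of_le' tendsto_const_nhds hup ?_ ?_
    · filter_upwards [hab, ha_pos] with n ⟨_, h₂, _⟩ ha
      exact (one_le_div ha).mpr h₂
    · filter_upwards [hab, ha_pos, hr_pos] with n ⟨h₁, _, h₃⟩ ha hrn
      rw [div_le_iff₀ ha]
      have h₄ : C / ((2 / 3) * π) * r n * ((2 / 3) * π * r n ^ 3) = C * r n ^ 4 := by
        field_simp
      have h₅ : C / ((2 / 3) * π) * r n * ((2 / 3) * π * r n ^ 3) ≤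
          C / ((2 / 3) * π) * r n * a n := by gcongr
      linarith
  have hdiff : Tendsto (fun n : ℕ => (n : ℝ) * (b n - a n)) atTop (nhds 0) := by
    have hup : Tendsto (fun n : ℕ => C * ((n : ℝ) * r n ^ 4)) atTop (nhds 0) := by
      simpa using hx_zero.const_mul C
    refine tendsto_of_tendsto_of_tendsto_of_le_of_le' tendsto_const_nhds hup ?_ ?_
    · filter_upwards [hab] with n ⟨_, h₂, _⟩
      exact mul_nonneg n.cast_nonneg (sub_nonneg.mpr h₂)
    · filter_upwards [hab] with n ⟨_, _, h₃⟩
      have : (n : ℝ) * (b n - a n) ≤ n * (C * r n ^ 4) := by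
        gcongr
        linarith
      linarith
  have h := (hquot.pow k).mul (Real.continuous_exp.tendsto _ |>.comp hdiff.neg)
  simp only [neg_zero, Real.exp_zero, one_pow, mul_one] at h
  refine h.congr' ?_
  filter_upwards [ha_pos, hpos] with n ha ⟨hn, _⟩
  have h₁ : -((n : ℝ) * (b n - a n)) = -(n * b n) - -(n * a n) := by ring
  simp only [Function.comp_apply]
  rw [h₁, Real.exp_sub, mul_div_mul_comm, ← div_pow, mul_div_mul_left _ _ hn.ne']
end

section
/- Let φ : ℝ² → ℝ be twice continuously differentiable (C²) with φ(0,0) = 0 and vanishing derivative at the origin (fderiv φ (0,0) = 0), and let Ω = {y ∈ ℝ³ : y₃ ≤ φ(y₁, y₂)} be the closed subgraph region whose boundary is the graph of φ. Then liminf_{r → 0⁺} volume(B(0,r) ∩ Ω) / volume(B(0,r)) ≥ 1/2, where B(0,r) is the closed ball of radius r centered at the origin of ℝ³ and volume is the three-dimensional Lebesgue measure. -/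
open Real MeasureTheory Filter

open scoped Topology Pointwise

/-- A nonzero linear functional is negative on half of any symmetric set. -/
theorem measure_eq_two_mul_measure_inter_neg {E : Type*} [NormedAddCommGroup E]
    [NormedSpace ℝ E] [MeasurableSpace E] [BorelSpace E] [FiniteDimensional ℝ E]
    (μ : Measure E) [μ.IsAddHaarMeasure] (f : E →L[ℝ] ℝ) (hf : f ≠ 0) {s : Set E}
    (hs : -s = s) :
    μ s = 2 * μ (s ∩ {x | f x < 0}) := by
  have hker : μ {x | f x = 0} = 0 := by
    refine Measure.addHaar_submodule μ (LinearMap.ker f.toLinearMap) fun h => hf ?_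
    ext x
    have hx : x ∈ LinearMap.ker f.toLinearMap := h ▸ Submodule.mem_top
    simpa using hx
  have hneg : μ (s ∩ {x | 0 < f x}) = μ (s ∩ {x | f x < 0}) := by
    rw [← Measure.measure_neg μ (s ∩ {x | f x < 0}), Set.inter_neg, hs]
    congr 2
    ext x
    simp
  have hmeas : MeasurableSet {x | f x < 0} :=
    measurableSet_lt f.continuous.measurable measurable_const
  have hdiff : μ (s \ {x | f x < 0}) = μ (s ∩ {x | 0 < f x}) := by
    refine measure_congr ?_
    have hae : ∀ᵐ x ∂μ, f x ≠ 0 := by simpa [ae_iff] using hker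
    filter_upwards [hae] with x hx
    refine propext (and_congr_right fun _ => ?_)
    exact not_lt.trans ⟨fun h => lt_of_le_of_ne h hx.symm, le_of_lt⟩
  rw [← measure_inter_add_sdiff s hmeas, hdiff, hneg, two_mul]

/-- If dilates of a set `K` of the unit ball are eventually contained in `Ω`, then the lower
density of `Ω` at the origin is at least the proportion of the unit ball filled by `K`. -/
theorem measure_div_le_liminf_measure_closedBall_inter {E : Type*} [NormedAddCommGroup E]
    [NormedSpace ℝ E] [MeasurableSpace E] [BorelSpace E] [FiniteDimensional ℝ E]
    (μ : Measure E) [μ.IsAddHaarMeasure] {K Ω : Set E} (hK : K ⊆ Metric.closedBall 0 1)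
    (hΩ : ∀ᶠ r : ℝ in 𝓝[>] 0, r • K ⊆ Ω) :
    μ K / μ (Metric.closedBall 0 1) ≤
      liminf (fun r : ℝ => μ (Metric.closedBall 0 r ∩ Ω) / μ (Metric.closedBall 0 r))
        (𝓝[>] 0) := by
  refine le_liminf_of_le (by isBoundedDefault) ?_
  filter_upwards [hΩ, self_mem_nhdsWithin] with r hr (hr0 : 0 < r)
  have hball : r • Metric.closedBall (0 : E) 1 = Metric.closedBall 0 r := by
    rw [smul_unitClosedBall_of_nonneg hr0.le]
  have hsub : r • K ⊆ Metric.closedBall 0 r ∩ Ω :=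
    Set.subset_inter (hball ▸ Set.smul_set_mono hK) hr
  calc μ K / μ (Metric.closedBall 0 1)
      = μ (r • K) / μ (r • Metric.closedBall (0 : E) 1) := by
        rw [Measure.addHaar_smul, Measure.addHaar_smul, ENNReal.mul_div_mul_left]
        · simpa using fun h => absurd h hr0.ne'
        · exact ENNReal.ofReal_ne_top
    _ ≤ μ (Metric.closedBall 0 r ∩ Ω) / μ (Metric.closedBall 0 r) := by
        rw [hball]
        gcongr

/-- Small dilates of the part of the unit ball at depth at least `ε` lie in the subgraph of a
function with vanishing value and derivative at the origin. -/
theorem eventually_smul_subset_subgraph {φ : ℝ × ℝ → ℝ}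
    (hφ : HasFDerivAt φ (0 : ℝ × ℝ →L[ℝ] ℝ) (0, 0))
    (hφ0 : φ (0, 0) = 0) {ε : ℝ} (hε : 0 < ε) :
    ∀ᶠ r : ℝ in 𝓝[>] 0,
      r • (Metric.closedBall (0 : EuclideanSpace ℝ (Fin 3)) 1 ∩ {y | y 2 ≤ -ε}) ⊆
        {y | y 2 ≤ φ (y 0, y 1)} := by
  have hlo : ∀ᶠ p : ℝ × ℝ in 𝓝 0, ‖φ p‖ ≤ ε * ‖p‖ := by
    have hφ0' : φ 0 = 0 := hφ0
    simpa [hφ0', Prod.mk_zero_zero] using (hasFDerivAt_iff_isLittleO.1 hφ).def hε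
  obtain ⟨δ, hδ, hball⟩ := Metric.eventually_nhds_iff.1 hlo
  filter_upwards [Ioo_mem_nhdsGT hδ] with r hr
  rintro _ ⟨y, ⟨hy1, hy2⟩, rfl⟩
  have hcoord (i : Fin 3) : |y i| ≤ 1 :=
    (PiLp.norm_apply_le y i).trans (mem_closedBall_zero_iff.1 hy1)
  have hnorm : ‖((r * y 0, r * y 1) : ℝ × ℝ)‖ ≤ r := by
    simp only [Prod.norm_def, Real.norm_eq_abs, abs_mul, abs_of_pos hr.1]
    exact max_le (mul_le_of_le_one_right hr.1.le (hcoord 0))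
      (mul_le_of_le_one_right hr.1.le (hcoord 1))
  have hφr := hball (y := (r * y 0, r * y 1)) (by simpa using hnorm.trans_lt hr.2)
  have hlower := neg_le_of_abs_le (hφr.trans (mul_le_mul_of_nonneg_left hnorm hε.le))
  have hdepth := mul_le_mul_of_nonneg_left (show y 2 ≤ -ε from hy2) hr.1.le
  change r * y 2 ≤ φ (r * y 0, r * y 1)
  linarith

/-- At a boundary point where the boundary is the graph of a `C²` function with horizontal
tangent plane, at least half of a small ball lies inside the subgraph region, in the liminf
sense as `r → 0⁺`. -/
theorem liminf_volume_ratio_ge_half (φ : ℝ × ℝ → ℝ)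
    (hφ : ContDiff ℝ 2 φ) (hφ0 : φ (0, 0) = 0) (hdφ0 : fderiv ℝ φ (0, 0) = 0) :
    (1 / 2 : ENNReal) ≤
      Filter.liminf
        (fun r : ℝ =>
          volume (Metric.closedBall (0 : EuclideanSpace ℝ (Fin 3)) r ∩
              {y : EuclideanSpace ℝ (Fin 3) | y 2 ≤ φ (y 0, y 1)}) /
            volume (Metric.closedBall (0 : EuclideanSpace ℝ (Fin 3)) r))
        (nhdsWithin 0 (Set.Ioi 0)) := by
  have hderiv : HasFDerivAt φ 0 (0, 0) :=
    hdφ0 ▸ (hφ.differentiable (by norm_num)).differentiableAt.hasFDerivAt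
  set B := Metric.closedBall (0 : EuclideanSpace ℝ (Fin 3)) 1
  have hB0 : volume B ≠ 0 := (Metric.measure_closedBall_pos _ _ one_pos).ne'
  have hBtop : volume B ≠ ⊤ := measure_closedBall_lt_top.ne
  let K : ℕ → Set (EuclideanSpace ℝ (Fin 3)) := fun n => B ∩ {y | y 2 ≤ -(1 / ((n : ℝ) + 1))}
  have hmono : Monotone K := fun m n hmn =>
    Set.inter_subset_inter_right _ fun y (hy : y 2 ≤ _) =>
      hy.trans (neg_le_neg (Nat.one_div_le_one_div hmn))
  have hunion : ⋃ n, K n = B ∩ {y | y 2 < 0} := by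
    rw [← Set.inter_iUnion]
    congr 1
    ext y
    simp only [Set.mem_iUnion, Set.mem_ofPred_eq]
    constructor
    · rintro ⟨n, hn⟩
      exact hn.trans_lt (neg_neg_of_pos Nat.one_div_pos_of_nat)
    · intro hy
      obtain ⟨n, hn⟩ := exists_nat_one_div_lt (neg_pos.2 hy)
      exact ⟨n, by linarith⟩
  have hhalf : volume B = 2 * volume (B ∩ {y | y 2 < 0}) := by
    refine measure_eq_two_mul_measure_inter_neg volume
      (EuclideanSpace.proj (2 : Fin 3) : EuclideanSpace ℝ (Fin 3) →L[ℝ] ℝ) (fun h => ?_)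
      (by simp [B])
    simpa using DFunLike.congr_fun h (EuclideanSpace.single 2 1)
  have hratio : volume (B ∩ {y | y 2 < 0}) / volume B = 1 / 2 := by
    rw [ENNReal.div_eq_div_iff two_ne_zero ENNReal.ofNat_ne_top hB0 hBtop, ← hhalf, mul_one]
  have htendsto : Tendsto (fun n => volume (K n) / volume B) atTop (𝓝 (1 / 2)) := by
    rw [← hratio, ← hunion]
    exact ENNReal.Tendsto.div_const (tendsto_measure_iUnion_atTop hmono) (Or.inr hB0)
  exact le_of_tendsto' htendsto fun n =>
    measure_div_le_liminf_measure_closedBall_inter volume Set.inter_subset_left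
      (eventually_smul_subset_subgraph hderiv hφ0 Nat.one_div_pos_of_nat)
end
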